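/- Let X be a real Hilbert space, Y a real normed space, S, T : X → Y bounded linear operators, and M := {(u, v) ∈ X × X : Su = Tv}. Then M is m-accretive if and only if the following three conditions hold: (a) ran(T − S) ⊆ ran(T + S); (b) T + S is injective; (c) for all u, v ∈ X, (S + T)v = (T − S)u implies ‖v‖ ≤ ‖u‖ (i.e. ‖(S+T)⁻¹(T−S)‖ ≤ 1). -/

import Mathlib

open RealInnerProductSpace

/-- A relation `M ⊆ X × X` is accretive if `⟪u - x, v - y⟫ ≥ 0` for all `(u, v), (x, y) ∈ M`. -/
def Accretive {X : Type*} [NormedAddCommGroup X] [InnerProductSpace ℝ X]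
    (M : Set (X × X)) : Prop :=
  ∀ p ∈ M, ∀ q ∈ M, 0 ≤ ⟪p.1 - q.1, p.2 - q.2⟫

/-- A relation `M ⊆ X × X` is m-accretive if it is accretive and `1 + M` is onto. -/
def MAccretive {X : Type*} [NormedAddCommGroup X] [InnerProductSpace ℝ X]
    (M : Set (X × X)) : Prop :=
  Accretive M ∧ ∀ f : X, ∃ p ∈ M, p.1 + p.2 = f

/-- Two vectors have nonnegative inner product iff their difference is no longer than their sum. -/
theorem inner_nonneg_iff_norm_sub_le_norm_add {X : Type*} [NormedAddCommGroup X]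
    [InnerProductSpace ℝ X] (u v : X) : 0 ≤ ⟪u, v⟫ ↔ ‖u - v‖ ≤ ‖u + v‖ := by
  rw [← sq_le_sq₀ (norm_nonneg _) (norm_nonneg _), norm_sub_sq_real, norm_add_sq_real]
  constructor <;> intro h <;> linarith

/-- The relation `S u = T v` in terms of the sum and the difference of `u` and `v`. -/
theorem map_eq_map_iff_add_map_sub {X Y : Type*} [NormedAddCommGroup X] [NormedSpace ℝ X]
    [NormedAddCommGroup Y] [NormedSpace ℝ Y] (S T : X →L[ℝ] Y) (u v : X) :
    S u = T v ↔ (S + T) (u - v) = (T - S) (u + v) := by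
  simp only [add_apply, sub_apply, map_add, map_sub]
  rw [← sub_eq_zero, ← sub_eq_zero (a := S u + T u - (S v + T v)),
    show S u + T u - (S v + T v) - (T u - S u + (T v - S v)) = (2 : ℝ) • (S u - T v) by module,
    smul_eq_zero_iff_right two_ne_zero]

/-- Every pair `(f, d)` consists of the sum and the difference of some pair `(u, v)`. -/
theorem exists_add_eq_sub_eq {X : Type*} [AddCommGroup X] [Module ℝ X] (f d : X) :
    ∃ u v : X, u + v = f ∧ u - v = d :=
  ⟨(1 / 2 : ℝ) • (f + d), (1 / 2 : ℝ) • (f - d), by module, by module⟩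

theorem accretive_setOf_map_eq_map_iff {X Y : Type*} [NormedAddCommGroup X]
    [InnerProductSpace ℝ X] [NormedAddCommGroup Y] [NormedSpace ℝ Y] (S T : X →L[ℝ] Y) :
    Accretive {p : X × X | S p.1 = T p.2} ↔
      ∀ u v : X, (S + T) v = (T - S) u → ‖v‖ ≤ ‖u‖ := by
  constructor
  · intro h f d hfd
    obtain ⟨u, v, rfl, rfl⟩ := exists_add_eq_sub_eq f d
    rw [← inner_nonneg_iff_norm_sub_le_norm_add]
    simpa using h (u, v) ((map_eq_map_iff_add_map_sub S T u v).2 hfd) (0, 0) (by simp)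
  · intro h p hp q hq
    rw [inner_nonneg_iff_norm_sub_le_norm_add]
    apply h
    rw [← map_eq_map_iff_add_map_sub, map_sub, map_sub, hp.out, hq.out]

theorem forall_exists_add_eq_iff_range_subset {X Y : Type*} [NormedAddCommGroup X]
    [NormedSpace ℝ X] [NormedAddCommGroup Y] [NormedSpace ℝ Y] (S T : X →L[ℝ] Y) :
    (∀ f : X, ∃ p ∈ {p : X × X | S p.1 = T p.2}, p.1 + p.2 = f) ↔
      Set.range ⇑(T - S) ⊆ Set.range ⇑(T + S) := by
  rw [Set.range_subset_iff, add_comm T S]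
  refine forall_congr' fun f ↦ ⟨?_, ?_⟩
  · rintro ⟨p, hp, rfl⟩
    exact ⟨p.1 - p.2, (map_eq_map_iff_add_map_sub S T p.1 p.2).1 hp⟩
  · rintro ⟨d, hd⟩
    obtain ⟨u, v, rfl, rfl⟩ := exists_add_eq_sub_eq f d
    exact ⟨(u, v), (map_eq_map_iff_add_map_sub S T u v).2 hd, rfl⟩

/-- For bounded operators `S, T : X → Y` (`X` a real Hilbert space, `Y`
a real normed space), the relation `M = {(u, v) : S u = T v}` is m-accretive iff
`ran (T - S) ⊆ ran (T + S)`, `T + S` is injective, and `‖(S + T)⁻¹ (T - S)‖ ≤ 1`. -/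
theorem stmt18 {X Y : Type*} [NormedAddCommGroup X] [InnerProductSpace ℝ X] [CompleteSpace X]
    [NormedAddCommGroup Y] [NormedSpace ℝ Y]
    (S T : X →L[ℝ] Y) :
    MAccretive {p : X × X | S p.1 = T p.2} ↔
      (Set.range ⇑(T - S) ⊆ Set.range ⇑(T + S) ∧
       Function.Injective ⇑(T + S) ∧
       ∀ u v : X, (S + T) v = (T - S) u → ‖v‖ ≤ ‖u‖) := by
  rw [MAccretive, accretive_setOf_map_eq_map_iff, forall_exists_add_eq_iff_range_subset]
  refine ⟨fun ⟨hc, ha⟩ ↦ ⟨ha, ?_, hc⟩, fun ⟨ha, _, hc⟩ ↦ ⟨hc, ha⟩⟩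
  rw [add_comm T S, injective_iff_map_eq_zero]
  intro v hv
  simpa using hc 0 v (by rw [hv, map_zero])
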